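/- Let {π_ℓ}_{ℓ=1}^L be deterministic Pareto front policies in a MOMDP with finite state space X and finite action space A, let X_common = {x ∈ X : π_1(x) = π_2(x) = ... = π_L(x)}, and for each ℓ let D_ℓ consist of N_ℓ i.i.d. state-action pairs sampled from the occupancy measure μ^{π_ℓ}; set N = Σ_ℓ N_ℓ and ν^{π_data}(x) = (Σ_ℓ N_ℓ ν^{π_ℓ}(x))/N. Let MA-BC form D_div = {(x,a) : there exist ℓ ≠ ℓ' and samples (x, a) ∈ D_ℓ, (x, a') ∈ D_{ℓ'} with a ≠ a'}, D_common = (∪_ℓ D_ℓ) with all occurrences of states appearing in D_div removed, and output π̂_ℓ as the maximizer of Σ_{(X,A) ∈ D_common ∪ D_ℓ} log π(A|X) that plays uniformly at random at states not appearing in D_common ∪ D_ℓ. Then for every ℓ ∈ [L], π̂_ℓ is an ε_ℓ-PF policy (where the expectation in the definition of ε_ℓ-PF is over the random datasets) with ε_ℓ = ‖ν^{π_ℓ}/ν^{π_data}‖_∞ · |X_common| / (e (1−γ)² N) + |X \ X_common| / (e (1−γ)² N_ℓ). -/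

import Mathlib

open scoped BigOperators
open Classical

/-- A Multi-Objective Markov Decision Process with finite state space `X`,
finite action space `A`, and `d`-dimensional rewards in `[0,1]^d`. -/
structure MOMDP (X A : Type) [Fintype X] [Fintype A] (d : ℕ) where
  P : X → A → X → ℝ
  P_nonneg : ∀ x a x', 0 ≤ P x a x'
  P_sum_one : ∀ x a, ∑ x', P x a x' = 1
  disc : ℝ
  disc_nonneg : 0 ≤ disc
  disc_lt_one : disc < 1
  init : X → ℝ
  init_nonneg : ∀ x, 0 ≤ init x
  init_sum_one : ∑ x, init x = 1
  r : X → A → Fin d → ℝ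
  r_nonneg : ∀ x a i, 0 ≤ r x a i
  r_le_one : ∀ x a i, r x a i ≤ 1

/-- A stationary (Markov) policy: a map from states to distributions over actions. -/
def IsPolicy {X A : Type} [Fintype A] (π : X → A → ℝ) : Prop :=
  (∀ x a, 0 ≤ π x a) ∧ ∀ x, ∑ a, π x a = 1

/-- The stochastic policy induced by a deterministic policy `f : X → A`. -/
noncomputable def detPolicy {X A : Type} (f : X → A) : X → A → ℝ :=
  fun x a => if a = f x then 1 else 0

/-- The distribution of the state at time `t` under policy `π`. -/
noncomputable def stateDist {X A : Type} [Fintype X] [Fintype A] {d : ℕ}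
    (M : MOMDP X A d) (π : X → A → ℝ) : ℕ → X → ℝ
  | 0 => M.init
  | t + 1 => fun x' => ∑ x, ∑ a, stateDist M π t x * π x a * M.P x a x'

/-- The expected discounted vector return `J(π)`, componentwise. -/
noncomputable def Jret {X A : Type} [Fintype X] [Fintype A] {d : ℕ}
    (M : MOMDP X A d) (π : X → A → ℝ) (i : Fin d) : ℝ :=
  ∑' t : ℕ, M.disc ^ t * ∑ x, ∑ a, stateDist M π t x * π x a * M.r x a i

/-- Pareto front policy: no stationary policy weakly dominates it in all objectives and
strictly in one. -/
def IsPF {X A : Type} [Fintype X] [Fintype A] {d : ℕ}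
    (M : MOMDP X A d) (π : X → A → ℝ) : Prop :=
  ¬ ∃ π' : X → A → ℝ, IsPolicy π' ∧ (∀ i, Jret M π i ≤ Jret M π' i) ∧
      ∃ j, Jret M π j < Jret M π' j

/-- The discounted state occupancy measure `ν^π`. -/
noncomputable def stateOcc {X A : Type} [Fintype X] [Fintype A] {d : ℕ}
    (M : MOMDP X A d) (π : X → A → ℝ) (x : X) : ℝ :=
  (1 - M.disc) * ∑' t : ℕ, M.disc ^ t * stateDist M π t x

/-- The discounted state-action occupancy measure `μ^π`. -/
noncomputable def occ {X A : Type} [Fintype X] [Fintype A] {d : ℕ}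
    (M : MOMDP X A d) (π : X → A → ℝ) (p : X × A) : ℝ :=
  stateOcc M π p.1 * π p.1 p.2

/-- `ε`-approximate Pareto front property for a (randomized) output with expected
return vector `EJ`. -/
def IsEpsPF {X A : Type} [Fintype X] [Fintype A] {d : ℕ}
    (M : MOMDP X A d) (EJ : Fin d → ℝ) (ε : ℝ) : Prop :=
  ¬ ∃ π : X → A → ℝ, IsPolicy π ∧ (∀ i, ε ≤ Jret M π i - EJ i) ∧
      ∃ j, ε < Jret M π j - EJ j

/-- A collection of `L` expert datasets, the `ℓ`-th containing `Nl ℓ` state-action pairs. -/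
abbrev DataSets (L : ℕ) (Nl : Fin L → ℕ) (X A : Type) : Type :=
  ∀ ℓ : Fin L, Fin (Nl ℓ) → X × A

/-- Probability of observing the dataset collection `D` when, for each `ℓ`, the
`Nl ℓ` samples of the `ℓ`-th dataset are drawn i.i.d. from the occupancy measure
`μ^{π_ℓ}` of the deterministic expert `π ℓ`. -/
noncomputable def dataProb {X A : Type} [Fintype X] [Fintype A] {d : ℕ} {L : ℕ}
    {Nl : Fin L → ℕ} (M : MOMDP X A d) (π : Fin L → X → A)
    (D : DataSets L Nl X A) : ℝ :=
  ∏ ℓ, ∏ n, occ M (detPolicy (π ℓ)) (D ℓ n)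

/-- A state is diverging in the dataset collection `D` if two distinct experts were
observed taking different actions at it. -/
def divState {X A : Type} {L : ℕ} {Nl : Fin L → ℕ}
    (D : DataSets L Nl X A) (x : X) : Prop :=
  ∃ ℓ ℓ' n n', ℓ ≠ ℓ' ∧ (D ℓ n).1 = x ∧ (D ℓ' n').1 = x ∧ (D ℓ n).2 ≠ (D ℓ' n').2

/-- Likelihood of the policy `π'` on the curated dataset `D_common ∪ D_ℓ`: a sample of
expert `ℓ'` is included iff `ℓ' = ℓ` or its state is not diverging.  (Maximizing this
likelihood is the same as maximizing the behavioral-cloning log-likelihood.) -/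
noncomputable def curatedLik {X A : Type} {L : ℕ} {Nl : Fin L → ℕ}
    (D : DataSets L Nl X A) (ℓ : Fin L) (π' : X → A → ℝ) : ℝ :=
  ∏ ℓ', ∏ n, if ℓ' = ℓ ∨ ¬ divState D (D ℓ' n).1
    then π' (D ℓ' n).1 (D ℓ' n).2 else 1

/-- A state appears in the curated dataset `D_common ∪ D_ℓ`. -/
def obsState {X A : Type} {L : ℕ} {Nl : Fin L → ℕ}
    (D : DataSets L Nl X A) (ℓ : Fin L) (x : X) : Prop :=
  ∃ ℓ' n, (ℓ' = ℓ ∨ ¬ divState D (D ℓ' n).1) ∧ (D ℓ' n).1 = x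

/-- Cardinality of `X_common`, the set of states where all experts agree. -/
noncomputable def commonCard {X A : Type} [Fintype X] {L : ℕ}
    (π : Fin L → X → A) : ℕ :=
  (Finset.univ.filter fun x => ∀ ℓ ℓ' : Fin L, π ℓ x = π ℓ' x).card

/-- The dataset-averaged state occupancy `ν^{π_data}(x) = (Σ_ℓ N_ℓ ν^{π_ℓ}(x)) / N`. -/
noncomputable def nuData {X A : Type} [Fintype X] [Fintype A] {d : ℕ} {L : ℕ}
    (M : MOMDP X A d) (Nl : Fin L → ℕ) (π : Fin L → X → A) (x : X) : ℝ :=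
  (∑ ℓ, (Nl ℓ : ℝ) * stateOcc M (detPolicy (π ℓ)) x) / (∑ ℓ, (Nl ℓ : ℝ))

/-- The concentrability coefficient `‖ν^{π_ℓ} / ν^{π_data}‖_∞`. -/
noncomputable def concentr {X A : Type} [Fintype X] [Fintype A] [Nonempty X] {d : ℕ}
    {L : ℕ} (M : MOMDP X A d) (Nl : Fin L → ℕ) (π : Fin L → X → A) (ℓ : Fin L) : ℝ :=
  Finset.univ.sup' Finset.univ_nonempty fun x =>
    stateOcc M (detPolicy (π ℓ)) x / nuData M Nl π x

/-- The MA-BC suboptimality level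
`ε_ℓ = ‖ν^{π_ℓ}/ν^{π_data}‖_∞ |X_common| / (e (1-γ)² N) + |X \ X_common| / (e (1-γ)² N_ℓ)`. -/
noncomputable def mabcEps {X A : Type} [Fintype X] [Fintype A] [Nonempty X] {d : ℕ}
    {L : ℕ} (M : MOMDP X A d) (Nl : Fin L → ℕ) (π : Fin L → X → A) (ℓ : Fin L) : ℝ :=
  concentr M Nl π ℓ * (commonCard π : ℝ) /
      (Real.exp 1 * (1 - M.disc) ^ 2 * ∑ ℓ', (Nl ℓ' : ℝ))
    + ((Fintype.card X : ℝ) - (commonCard π : ℝ)) /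
      (Real.exp 1 * (1 - M.disc) ^ 2 * (Nl ℓ : ℝ))

section Helpers

variable {X A : Type} [Fintype X] [Fintype A] {d : ℕ}

lemma detPolicy_isPolicy (f : X → A) : IsPolicy (detPolicy f) := by
  constructor
  · intro x a
    unfold detPolicy
    split_ifs <;> norm_num
  · intro x
    simp [detPolicy]

lemma stateDist_nonneg (M : MOMDP X A d) {π : X → A → ℝ} (h : IsPolicy π) (t : ℕ) (x : X) :
    0 ≤ stateDist M π t x := by
  induction t generalizing x with
  | zero => exact M.init_nonneg x
  | succ t ih =>
    simp only [stateDist]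
    exact Finset.sum_nonneg fun y _ => Finset.sum_nonneg fun a _ =>
      mul_nonneg (mul_nonneg (ih y) (h.1 y a)) (M.P_nonneg _ _ _)

lemma stateDist_sum (M : MOMDP X A d) {π : X → A → ℝ} (h : IsPolicy π) (t : ℕ) :
    ∑ x, stateDist M π t x = 1 := by
  induction t with
  | zero => exact M.init_sum_one
  | succ t ih =>
    simp only [stateDist]
    rw [Finset.sum_comm]
    rw [← ih]
    refine Finset.sum_congr rfl fun x _ => ?_
    rw [Finset.sum_comm]
    simp only [← Finset.mul_sum, M.P_sum_one, mul_one, h.2]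

lemma stateDist_le_one (M : MOMDP X A d) {π : X → A → ℝ} (h : IsPolicy π) (t : ℕ) (x : X) :
    stateDist M π t x ≤ 1 := by
  rw [← stateDist_sum M h t]
  exact Finset.single_le_sum (fun y _ => stateDist_nonneg M h t y) (Finset.mem_univ x)

lemma summable_disc_mul (M : MOMDP X A d) (f : ℕ → ℝ) (C : ℝ)
    (h0 : ∀ t, 0 ≤ f t) (h1 : ∀ t, f t ≤ C) : Summable fun t => M.disc ^ t * f t := by
  refine Summable.of_nonneg_of_le (fun t => mul_nonneg (pow_nonneg M.disc_nonneg t) (h0 t))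
    (fun t => mul_le_mul_of_nonneg_left (h1 t) (pow_nonneg M.disc_nonneg t)) ?_
  exact (summable_geometric_of_lt_one M.disc_nonneg M.disc_lt_one).mul_right C

lemma stateOcc_nonneg (M : MOMDP X A d) {π : X → A → ℝ} (h : IsPolicy π) (x : X) :
    0 ≤ stateOcc M π x := by
  unfold stateOcc
  exact mul_nonneg (by linarith [M.disc_lt_one])
    (tsum_nonneg fun t => mul_nonneg (pow_nonneg M.disc_nonneg t) (stateDist_nonneg M h t x))

lemma stateDist_summable (M : MOMDP X A d) {π : X → A → ℝ} (h : IsPolicy π) (x : X) :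
    Summable fun t => M.disc ^ t * stateDist M π t x :=
  summable_disc_mul M _ 1 (fun t => stateDist_nonneg M h t x) (fun t => stateDist_le_one M h t x)

lemma stateOcc_sum_mul (M : MOMDP X A d) {π : X → A → ℝ} (h : IsPolicy π) (f : X → ℝ) :
    ∑ x, stateOcc M π x * f x
      = (1 - M.disc) * ∑' t, M.disc ^ t * ∑ x, stateDist M π t x * f x := by
  have : ∀ t, M.disc ^ t * ∑ x, stateDist M π t x * f x
      = ∑ x, (M.disc ^ t * stateDist M π t x) * f x := by
    intro t
    rw [Finset.mul_sum]
    exact Finset.sum_congr rfl fun x _ => by ring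
  simp only [this]
  rw [Summable.tsum_finsetSum (fun x _ => (stateDist_summable M h x).mul_right (f x)),
    Finset.mul_sum]
  refine Finset.sum_congr rfl fun x _ => ?_
  rw [tsum_mul_right, stateOcc]
  ring

lemma stateOcc_sum (M : MOMDP X A d) {π : X → A → ℝ} (h : IsPolicy π) :
    ∑ x, stateOcc M π x = 1 := by
  have := stateOcc_sum_mul M h (fun _ => 1)
  simp only [mul_one, stateDist_sum M h] at this
  rw [this, tsum_geometric_of_lt_one M.disc_nonneg M.disc_lt_one]
  exact mul_inv_cancel₀ (by linarith [M.disc_lt_one])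

/-- Performance difference bound. -/
lemma perf_diff (M : MOMDP X A d) (f : X → A) {ρ : X → A → ℝ} (h : IsPolicy ρ) (i : Fin d) :
    Jret M (detPolicy f) i - Jret M ρ i
      ≤ (1 / (1 - M.disc) ^ 2) * ∑ x, stateOcc M (detPolicy f) x * (1 - ρ x (f x)) := by
  have hd := detPolicy_isPolicy (X := X) f
  set σ := detPolicy f with hσ
  have hγ : 0 < 1 - M.disc := by linarith [M.disc_lt_one]
  have hρ1 : ∀ x a, ρ x a ≤ 1 := fun x a => by
    rw [← h.2 x]
    exact Finset.single_le_sum (fun b _ => h.1 x b) (Finset.mem_univ a)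
  set p := stateDist M σ with hp
  set q := stateDist M ρ with hq
  have hp0 : ∀ t x, 0 ≤ p t x := fun t x => stateDist_nonneg M hd t x
  have hq0 : ∀ t x, 0 ≤ q t x := fun t x => stateDist_nonneg M h t x
  let H : ℕ → ℝ := fun t => ∑ x, max (p t x - q t x) 0
  let K : ℕ → ℝ := fun t => ∑ x, ∑ a, max (p t x * σ x a - q t x * ρ x a) 0
  let E : ℕ → ℝ := fun t => ∑ x, p t x * (1 - ρ x (f x))
  have hH0 : ∀ t, 0 ≤ H t := fun t => Finset.sum_nonneg fun x _ => le_max_right _ _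
  have hK0 : ∀ t, 0 ≤ K t := fun t => Finset.sum_nonneg fun x _ =>
    Finset.sum_nonneg fun a _ => le_max_right _ _
  have hE0 : ∀ t, 0 ≤ E t := fun t => Finset.sum_nonneg fun x _ =>
    mul_nonneg (hp0 t x) (by linarith [hρ1 x (f x)])
  have hH1 : ∀ t, H t ≤ 1 := fun t => by
    rw [← stateDist_sum M hd t]
    exact Finset.sum_le_sum fun x _ => max_le (by linarith [hq0 t x]) (hp0 t x)
  have hE1 : ∀ t, E t ≤ 1 := fun t => by
    rw [← stateDist_sum M hd t]
    exact Finset.sum_le_sum fun x _ =>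
      mul_le_of_le_one_right (hp0 t x) (by linarith [h.1 x (f x)])
  have hHK : ∀ t, H (t + 1) ≤ K t := by
    intro t
    have : ∀ x', max (p (t+1) x' - q (t+1) x') 0
        ≤ ∑ x, ∑ a, max (p t x * σ x a - q t x * ρ x a) 0 * M.P x a x' := by
      intro x'
      refine max_le ?_ (Finset.sum_nonneg fun x _ => Finset.sum_nonneg fun a _ =>
        mul_nonneg (le_max_right _ _) (M.P_nonneg _ _ _))
      have e1 : p (t+1) x' = ∑ x, ∑ a, p t x * σ x a * M.P x a x' := rfl
      have e2 : q (t+1) x' = ∑ x, ∑ a, q t x * ρ x a * M.P x a x' := rfl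
      rw [e1, e2, ← Finset.sum_sub_distrib]
      refine Finset.sum_le_sum fun x _ => ?_
      rw [← Finset.sum_sub_distrib]
      refine Finset.sum_le_sum fun a _ => ?_
      rw [← sub_mul]
      exact mul_le_mul_of_nonneg_right (le_max_left _ _) (M.P_nonneg _ _ _)
    refine (Finset.sum_le_sum fun x' _ => this x').trans (le_of_eq ?_)
    rw [Finset.sum_comm]
    refine Finset.sum_congr rfl fun x _ => ?_
    rw [Finset.sum_comm]
    refine Finset.sum_congr rfl fun a _ => ?_
    rw [← Finset.mul_sum, M.P_sum_one, mul_one]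
  have hpos : ∀ x, ∑ a, max (σ x a - ρ x a) 0 = 1 - ρ x (f x) := by
    intro x
    rw [Finset.sum_eq_single (f x)]
    · simp only [hσ, detPolicy, if_true]
      exact max_eq_left (by linarith [hρ1 x (f x)])
    · intro a _ ha
      simp only [hσ, detPolicy, if_neg ha]
      exact max_eq_right (by linarith [h.1 x a])
    · intro h; exact absurd (Finset.mem_univ _) h
  have hKH : ∀ t, K t ≤ H t + E t := by
    intro t
    simp only [K, H, E]
    rw [← Finset.sum_add_distrib]
    refine Finset.sum_le_sum fun x _ => ?_
    have e : max (p t x - q t x) 0 + p t x * (1 - ρ x (f x))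
        = ∑ a, (max (p t x - q t x) 0 * ρ x a + p t x * max (σ x a - ρ x a) 0) := by
      rw [Finset.sum_add_distrib, ← Finset.mul_sum, ← Finset.mul_sum, h.2, hpos, mul_one]
    rw [e]
    refine Finset.sum_le_sum fun a _ => max_le ?_ ?_
    · have h1 := mul_le_mul_of_nonneg_right (le_max_left (p t x - q t x) 0) (h.1 x a)
      have h2 := mul_le_mul_of_nonneg_left (le_max_left (σ x a - ρ x a) 0) (hp0 t x)
      nlinarith
    · exact add_nonneg (mul_nonneg (le_max_right _ _) (h.1 x a))
        (mul_nonneg (hp0 t x) (le_max_right _ _))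
  have hK2 : ∀ t, K t ≤ 2 := fun t => by linarith [hKH t, hH1 t, hE1 t]
  have sH := summable_disc_mul M H 1 hH0 hH1
  have sK := summable_disc_mul M K 2 hK0 hK2
  have sE := summable_disc_mul M E 1 hE0 hE1
  have sJ : ∀ {τ : X → A → ℝ}, IsPolicy τ → Summable fun t =>
      M.disc ^ t * ∑ x, ∑ a, stateDist M τ t x * τ x a * M.r x a i := by
    intro τ hτ
    refine summable_disc_mul M _ 1 (fun t => Finset.sum_nonneg fun x _ =>
      Finset.sum_nonneg fun a _ => mul_nonneg (mul_nonneg (stateDist_nonneg M hτ t x) (hτ.1 x a))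
        (M.r_nonneg _ _ _)) (fun t => ?_)
    rw [← stateDist_sum M hτ t]
    refine Finset.sum_le_sum fun x _ => ?_
    have : stateDist M τ t x = ∑ a, stateDist M τ t x * τ x a := by
      rw [← Finset.mul_sum, hτ.2, mul_one]
    rw [this]
    refine Finset.sum_le_sum fun a _ => ?_
    rw [← this]
    exact mul_le_of_le_one_right (mul_nonneg (stateDist_nonneg M hτ t x) (hτ.1 x a))
      (M.r_le_one _ _ _)
  have hJK : Jret M σ i - Jret M ρ i ≤ ∑' t, M.disc ^ t * K t := by
    unfold Jret
    rw [← (sJ hd).tsum_sub (sJ h)]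
    refine Summable.tsum_le_tsum (fun t => ?_) ((sJ hd).sub (sJ h)) sK
    rw [← mul_sub]
    refine mul_le_mul_of_nonneg_left ?_ (pow_nonneg M.disc_nonneg t)
    rw [← Finset.sum_sub_distrib]
    refine Finset.sum_le_sum fun x _ => ?_
    rw [← Finset.sum_sub_distrib]
    refine Finset.sum_le_sum fun a _ => ?_
    rw [← sub_mul]
    exact (mul_le_mul_of_nonneg_right (le_max_left _ 0) (M.r_nonneg _ _ _)).trans
      (mul_le_of_le_one_right (le_max_right _ _) (M.r_le_one _ _ _))
  have hKsum : ∑' t, M.disc ^ t * K t ≤ ∑' t, M.disc ^ t * H t + ∑' t, M.disc ^ t * E t := by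
    rw [← sH.tsum_add sE]
    refine Summable.tsum_le_tsum (fun t => ?_) sK (sH.add sE)
    rw [← mul_add]
    exact mul_le_mul_of_nonneg_left (hKH t) (pow_nonneg M.disc_nonneg t)
  have hHsum : ∑' t, M.disc ^ t * H t ≤ M.disc * ∑' t, M.disc ^ t * K t := by
    rw [sH.tsum_eq_zero_add, ← tsum_mul_left]
    have : H 0 = 0 := by
      simp only [H, hp, hq, stateDist, sub_self, max_self, Finset.sum_const_zero]
    rw [this, mul_zero, zero_add]
    refine Summable.tsum_le_tsum (fun t => ?_) ((summable_nat_add_iff 1).2 sH) (sK.mul_left _)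
    rw [pow_succ', mul_assoc]
    exact mul_le_mul_of_nonneg_left (mul_le_mul_of_nonneg_left (hHK t)
      (pow_nonneg M.disc_nonneg t)) M.disc_nonneg
  have hE : ∑ x, stateOcc M σ x * (1 - ρ x (f x)) = (1 - M.disc) * ∑' t, M.disc ^ t * E t :=
    stateOcc_sum_mul M hd _
  rw [hE]
  have e : 1 / (1 - M.disc) ^ 2 * ((1 - M.disc) * ∑' t, M.disc ^ t * E t)
      = (∑' t, M.disc ^ t * E t) / (1 - M.disc) := by
    field_simp
  rw [e]
  refine hJK.trans ?_
  rw [le_div_iff₀ hγ]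
  linarith

/-- Sums over dataset collections of product functions factor. -/
lemma sum_data_prod {L : ℕ} {Nl : Fin L → ℕ} (g : Fin L → X × A → ℝ) :
    ∑ D : DataSets L Nl X A, ∏ ℓ, ∏ n, g ℓ (D ℓ n) = ∏ ℓ, (∑ p, g ℓ p) ^ Nl ℓ := by
  have h1 := Finset.prod_univ_sum (fun ℓ : Fin L => (Finset.univ : Finset (Fin (Nl ℓ) → X × A)))
    (fun ℓ v => ∏ n, g ℓ (v n))
  rw [Fintype.piFinset_univ] at h1
  rw [← h1]
  refine Finset.prod_congr rfl fun ℓ _ => ?_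
  have h2 := Finset.prod_univ_sum (fun _ : Fin (Nl ℓ) => (Finset.univ : Finset (X × A)))
    (fun _ p => g ℓ p)
  rw [Fintype.piFinset_univ] at h2
  rw [← h2]
  simp

lemma occ_nonneg (M : MOMDP X A d) (f : X → A) (p : X × A) : 0 ≤ occ M (detPolicy f) p :=
  mul_nonneg (stateOcc_nonneg M (detPolicy_isPolicy f) _) ((detPolicy_isPolicy f).1 _ _)

lemma occ_sum_mul (M : MOMDP X A d) (f : X → A) (w : X → ℝ) :
    ∑ p : X × A, occ M (detPolicy f) p * w p.1 = ∑ x, stateOcc M (detPolicy f) x * w x := by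
  rw [Fintype.sum_prod_type]
  refine Finset.sum_congr rfl fun x _ => ?_
  simp only [occ]
  rw [← Finset.sum_mul, ← Finset.mul_sum, (detPolicy_isPolicy f).2, mul_one]

lemma dataProb_nonneg {L : ℕ} {Nl : Fin L → ℕ} (M : MOMDP X A d) (π : Fin L → X → A)
    (D : DataSets L Nl X A) : 0 ≤ dataProb M π D :=
  Finset.prod_nonneg fun _ _ => Finset.prod_nonneg fun _ _ => occ_nonneg M _ _

lemma dataProb_sum {L : ℕ} {Nl : Fin L → ℕ} (M : MOMDP X A d) (π : Fin L → X → A) :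
    ∑ D : DataSets L Nl X A, dataProb M π D = 1 := by
  unfold dataProb
  rw [sum_data_prod (fun ℓ p => occ M (detPolicy (π ℓ)) p)]
  refine Finset.prod_eq_one fun ℓ _ => ?_
  have := occ_sum_mul M (π ℓ) (fun _ => 1)
  simp only [mul_one, stateOcc_sum M (detPolicy_isPolicy (π ℓ))] at this
  rw [this, one_pow]

lemma dataProb_support {L : ℕ} {Nl : Fin L → ℕ} (M : MOMDP X A d) (π : Fin L → X → A)
    (D : DataSets L Nl X A) (h : dataProb M π D ≠ 0) (ℓ : Fin L) (n : Fin (Nl ℓ)) :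
    (D ℓ n).2 = π ℓ (D ℓ n).1 := by
  by_contra hne
  apply h
  refine Finset.prod_eq_zero (Finset.mem_univ ℓ) (Finset.prod_eq_zero (Finset.mem_univ n) ?_)
  simp [occ, detPolicy, hne]

/-- Probability that state `x` is unseen in the datasets indexed by `S`. -/
lemma prob_unseen {L : ℕ} {Nl : Fin L → ℕ} (M : MOMDP X A d) (π : Fin L → X → A)
    (S : Finset (Fin L)) (x : X) :
    ∑ D : DataSets L Nl X A, dataProb M π D * (if ∃ ℓ ∈ S, ∃ n, (D ℓ n).1 = x then 0 else 1)
      ≤ Real.exp (- ∑ ℓ ∈ S, (Nl ℓ : ℝ) * stateOcc M (detPolicy (π ℓ)) x) := by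
  have e : ∀ D : DataSets L Nl X A,
      dataProb M π D * (if ∃ ℓ ∈ S, ∃ n, (D ℓ n).1 = x then 0 else 1)
      = ∏ ℓ, ∏ n, (fun ℓ (p : X × A) => occ M (detPolicy (π ℓ)) p *
          (if ℓ ∈ S ∧ p.1 = x then (0:ℝ) else 1)) ℓ (D ℓ n) := by
    intro D
    simp only [Finset.prod_mul_distrib]
    unfold dataProb
    congr 1
    split_ifs with hc
    · obtain ⟨ℓ, hℓ, n, hn⟩ := hc
      symm
      refine Finset.prod_eq_zero (Finset.mem_univ ℓ) (Finset.prod_eq_zero (Finset.mem_univ n) ?_)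
      simp [hℓ, hn]
    · symm
      refine Finset.prod_eq_one fun ℓ _ => Finset.prod_eq_one fun n _ => if_neg ?_
      rintro ⟨h1, h2⟩
      exact hc ⟨ℓ, h1, n, h2⟩
  rw [Finset.sum_congr rfl (fun D _ => e D), sum_data_prod (fun ℓ (p : X × A) => occ M (detPolicy (π ℓ)) p *
          (if ℓ ∈ S ∧ p.1 = x then (0:ℝ) else 1))]
  have key : ∀ ℓ, (∑ p : X × A, occ M (detPolicy (π ℓ)) p *
      (if ℓ ∈ S ∧ p.1 = x then (0:ℝ) else 1)) =
      if ℓ ∈ S then 1 - stateOcc M (detPolicy (π ℓ)) x else 1 := by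
    intro ℓ
    have h1 := occ_sum_mul M (π ℓ) (fun y => if ℓ ∈ S ∧ y = x then (0:ℝ) else 1)
    have hs := stateOcc_sum M (detPolicy_isPolicy (X := X) (π ℓ))
    rw [h1]
    by_cases hS : ℓ ∈ S
    · simp only [hS, true_and, if_true]
      have : ∀ y, stateOcc M (detPolicy (π ℓ)) y * (if y = x then (0:ℝ) else 1)
          = stateOcc M (detPolicy (π ℓ)) y - (if y = x then stateOcc M (detPolicy (π ℓ)) y else 0) := by
        intro y
        split_ifs <;> ring
      simp only [this, Finset.sum_sub_distrib, hs, Finset.sum_ite_eq', Finset.mem_univ, if_true]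
    · simp only [hS, false_and, if_false, mul_one, hs]
  simp only [key]
  rw [← Finset.sum_neg_distrib, Real.exp_sum]
  have e2 : ∏ ℓ ∈ S, Real.exp (-((Nl ℓ : ℝ) * stateOcc M (detPolicy (π ℓ)) x))
      = ∏ ℓ, if ℓ ∈ S then Real.exp (-((Nl ℓ : ℝ) * stateOcc M (detPolicy (π ℓ)) x)) else 1 := by
    simp [Finset.prod_ite_mem]
  rw [e2]
  have hle1 : ∀ ℓ, stateOcc M (detPolicy (π ℓ)) x ≤ 1 := fun ℓ => by
    rw [← stateOcc_sum M (detPolicy_isPolicy (π ℓ))]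
    exact Finset.single_le_sum
      (fun y _ => stateOcc_nonneg M (detPolicy_isPolicy (π ℓ)) y) (Finset.mem_univ x)
  refine Finset.prod_le_prod (fun ℓ _ => ?_) (fun ℓ _ => ?_)
  · split_ifs
    · exact pow_nonneg (by linarith [hle1 ℓ]) _
    · simp
  · split_ifs
    · have h1 := Real.add_one_le_exp (-(stateOcc M (detPolicy (π ℓ)) x))
      have h2 := pow_le_pow_left₀ (by linarith [hle1 ℓ])
        (show 1 - stateOcc M (detPolicy (π ℓ)) x ≤ _ by linarith) (Nl ℓ)
      rw [← Real.exp_nat_mul] at h2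
      simpa using h2
    · simp

/-- The maximum-likelihood policy plays observed actions deterministically. -/
lemma hat_eq_one {L : ℕ} {Nl : Fin L → ℕ} (π : Fin L → X → A) (D : DataSets L Nl X A)
    (hD : ∀ ℓ n, (D ℓ n).2 = π ℓ (D ℓ n).1) (ℓ : Fin L) (ρ : X → A → ℝ) (hρ : IsPolicy ρ)
    (hmax : ∀ π' : X → A → ℝ, IsPolicy π' → curatedLik D ℓ π' ≤ curatedLik D ℓ ρ)
    (ℓ' : Fin L) (n : Fin (Nl ℓ')) (hc : ℓ' = ℓ ∨ ¬ divState D (D ℓ' n).1) :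
    ρ (D ℓ' n).1 (D ℓ' n).2 = 1 := by
  have hρ1 : ∀ x a, ρ x a ≤ 1 := fun x a => by
    rw [← hρ.2 x]
    exact Finset.single_le_sum (fun b _ => hρ.1 x b) (Finset.mem_univ a)
  have hex : ∃ g : X → A, ∀ k m, (k = ℓ ∨ ¬ divState D (D k m).1) → (D k m).2 = g (D k m).1 := by
    have : ∀ x, ∃ a, ∀ k m, (k = ℓ ∨ ¬ divState D (D k m).1) → (D k m).1 = x → (D k m).2 = a := by
      intro x
      by_cases hdiv : divState D x
      · refine ⟨π ℓ x, ?_⟩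
        rintro k m (rfl | hnd) rfl
        · exact hD _ _
        · exact absurd hdiv hnd
      · by_cases hob : ∃ k m, (D k m).1 = x
        · obtain ⟨k, m, hkm⟩ := hob
          refine ⟨(D k m).2, fun k' m' _ hx => ?_⟩
          by_cases hk : k' = k
          · subst hk
            rw [hD, hD, hx, hkm]
          · by_contra hne
            exact hdiv ⟨k', k, m', m, hk, hx, hkm, hne⟩
        · exact ⟨π ℓ x, fun k m _ hx => absurd ⟨k, m, hx⟩ hob⟩
    choose g hg using this
    exact ⟨g, fun k m h => hg _ k m h rfl⟩
  obtain ⟨g, hg⟩ := hex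
  have h1 : curatedLik D ℓ (detPolicy g) = 1 := by
    refine Finset.prod_eq_one fun k _ => Finset.prod_eq_one fun m _ => ?_
    split_ifs with h
    · simp [detPolicy, hg k m h]
    · rfl
  have h2 := hmax _ (detPolicy_isPolicy g)
  rw [h1] at h2
  let F : (k : Fin L) → Fin (Nl k) → ℝ := fun k m =>
    if k = ℓ ∨ ¬ divState D (D k m).1 then ρ (D k m).1 (D k m).2 else 1
  have F0 : ∀ k m, 0 ≤ F k m := fun k m => by
    simp only [F]; split_ifs
    · exact hρ.1 _ _
    · norm_num
  have F1 : ∀ k m, F k m ≤ 1 := fun k m => by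
    simp only [F]; split_ifs
    · exact hρ1 _ _
    · exact le_rfl
  have G1 : ∀ k, ∏ m, F k m ≤ 1 := fun k =>
    Finset.prod_le_one (fun m _ => F0 k m) (fun m _ => F1 k m)
  have G0 : ∀ k, 0 ≤ ∏ m, F k m := fun k => Finset.prod_nonneg fun m _ => F0 k m
  have h3 : curatedLik D ℓ ρ = ∏ k, ∏ m, F k m := rfl
  have h4 : ∏ k, ∏ m, F k m ≤ ∏ m, F ℓ' m := by
    rw [← Finset.mul_prod_erase _ _ (Finset.mem_univ ℓ')]
    exact mul_le_of_le_one_right (G0 _)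
      (Finset.prod_le_one (fun k _ => G0 k) (fun k _ => G1 k))
  have h5 : ∏ m, F ℓ' m ≤ F ℓ' n := by
    rw [← Finset.mul_prod_erase _ _ (Finset.mem_univ n)]
    exact mul_le_of_le_one_right (F0 _ _)
      (Finset.prod_le_one (fun m _ => F0 _ m) (fun m _ => F1 _ m))
  have h6 : F ℓ' n = ρ (D ℓ' n).1 (D ℓ' n).2 := if_pos hc
  rw [← h6]
  exact le_antisymm (F1 _ _) (by linarith)

lemma mul_exp_neg_le (N y : ℝ) (hN : 0 < N) :
    y * Real.exp (-(N * y)) ≤ 1 / (Real.exp 1 * N) := by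
  have h1 := Real.add_one_le_exp (N * y - 1)
  have h2 : N * y ≤ Real.exp (N * y) / Real.exp 1 := by
    rw [← Real.exp_sub]; linarith
  rw [Real.exp_neg, ← div_eq_mul_inv, div_le_div_iff₀ (Real.exp_pos _) (by positivity)]
  rw [le_div_iff₀ (Real.exp_pos _)] at h2
  linarith

end Helpers

/-- **MA-BC guarantee.** If the experts `π ℓ` are deterministic Pareto front policies and,
for every realization `D` of the random datasets, the output `hat D ℓ` is a stationary
policy maximizing the behavioral-cloning likelihood over the curated dataset
`D_common ∪ D_ℓ` and playing uniformly at random at unobserved states, then the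
(expectation over the datasets of the) output for expert `ℓ` is an `ε_ℓ`-approximate
Pareto front policy with
`ε_ℓ = ‖ν^{π_ℓ}/ν^{π_data}‖_∞ |X_common|/(e(1-γ)²N) + |X \ X_common|/(e(1-γ)²N_ℓ)`. -/
theorem mabc_guarantee {X A : Type} [Fintype X] [Fintype A] [Nonempty X] {d : ℕ}
    (M : MOMDP X A d) (L : ℕ) (Nl : Fin L → ℕ) (hNl : ∀ ℓ, 1 ≤ Nl ℓ)
    (π : Fin L → X → A) (hPF : ∀ ℓ, IsPF M (detPolicy (π ℓ)))
    (hat : DataSets L Nl X A → Fin L → X → A → ℝ)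
    (hat_pol : ∀ D ℓ, IsPolicy (hat D ℓ))
    (hat_max : ∀ D ℓ (π' : X → A → ℝ), IsPolicy π' →
      curatedLik D ℓ π' ≤ curatedLik D ℓ (hat D ℓ))
    (hat_unif : ∀ D ℓ x, ¬ obsState D ℓ x →
      ∀ a, hat D ℓ x a = 1 / (Fintype.card A : ℝ)) :
    ∀ ℓ, IsEpsPF M
      (fun i => ∑ D : DataSets L Nl X A, dataProb M π D * Jret M (hat D ℓ) i)
      (mabcEps M Nl π ℓ) := by
  intro ℓ
  suffices hmain : ∀ i, Jret M (detPolicy (π ℓ)) i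
      - ∑ D : DataSets L Nl X A, dataProb M π D * Jret M (hat D ℓ) i ≤ mabcEps M Nl π ℓ by
    rintro ⟨ρ, hρ, hall, j, hj⟩
    refine hPF ℓ ⟨ρ, hρ, fun i => ?_, j, ?_⟩
    · have h1 := hall i
      have h2 := hmain i
      simp only at h1
      linarith
    · have h2 := hmain j
      simp only at hj
      linarith
  intro i
  set ν := stateOcc M (detPolicy (π ℓ)) with hν
  have hν0 : ∀ x, 0 ≤ ν x := stateOcc_nonneg M (detPolicy_isPolicy (π ℓ))
  have hγ : 0 < 1 - M.disc := by linarith [M.disc_lt_one]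
  set N : ℝ := ∑ ℓ', (Nl ℓ' : ℝ) with hN
  have hNl0 : (0:ℝ) < Nl ℓ := by exact_mod_cast hNl ℓ
  have hN0 : 0 < N := lt_of_lt_of_le hNl0
    (Finset.single_le_sum (f := fun k => (Nl k : ℝ)) (fun k _ => Nat.cast_nonneg _)
      (Finset.mem_univ ℓ))
  have hstep1 : Jret M (detPolicy (π ℓ)) i
      - ∑ D : DataSets L Nl X A, dataProb M π D * Jret M (hat D ℓ) i
      ≤ (1 / (1 - M.disc) ^ 2) *
        ∑ x, ν x * ∑ D : DataSets L Nl X A, dataProb M π D * (1 - hat D ℓ x (π ℓ x)) := by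
    have e1 : Jret M (detPolicy (π ℓ)) i
        = ∑ D : DataSets L Nl X A, dataProb M π D * Jret M (detPolicy (π ℓ)) i := by
      rw [← Finset.sum_mul, dataProb_sum, one_mul]
    rw [e1, ← Finset.sum_sub_distrib]
    have e2 : (1 / (1 - M.disc) ^ 2) *
        ∑ x, ν x * ∑ D : DataSets L Nl X A, dataProb M π D * (1 - hat D ℓ x (π ℓ x))
        = ∑ D : DataSets L Nl X A, dataProb M π D * ((1 / (1 - M.disc) ^ 2) *
          ∑ x, ν x * (1 - hat D ℓ x (π ℓ x))) := by
      simp only [Finset.mul_sum]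
      rw [Finset.sum_comm]
      exact Finset.sum_congr rfl fun D _ => Finset.sum_congr rfl fun x _ => by ring
    rw [e2]
    refine Finset.sum_le_sum fun D _ => ?_
    rw [← mul_sub]
    exact mul_le_mul_of_nonneg_left (perf_diff M (π ℓ) (hat_pol D ℓ) i) (dataProb_nonneg M π D)
  -- bound on the error probability through an unseen event
  have hS : ∀ (S : Finset (Fin L)) (x : X),
      (∀ ℓ' ∈ S, ℓ' = ℓ ∨ ∀ k k' : Fin L, π k x = π k' x) →
      ∑ D : DataSets L Nl X A, dataProb M π D * (1 - hat D ℓ x (π ℓ x))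
        ≤ Real.exp (- ∑ ℓ' ∈ S, (Nl ℓ' : ℝ) * stateOcc M (detPolicy (π ℓ')) x) := by
    intro S x hx
    refine le_trans (Finset.sum_le_sum fun D _ => ?_) (prob_unseen M π S x)
    by_cases hD0 : dataProb M π D = 0
    · simp [hD0]
    have hD := dataProb_support M π D hD0
    refine mul_le_mul_of_nonneg_left ?_ (dataProb_nonneg M π D)
    split_ifs with hc
    · obtain ⟨ℓ', hℓ', n, hn⟩ := hc
      have hone := hat_eq_one π D hD ℓ (hat D ℓ) (hat_pol D ℓ) (hat_max D ℓ) ℓ' n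
      rcases hx ℓ' hℓ' with rfl | hcom
      · have := hone (Or.inl rfl)
        rw [hD, hn] at this
        rw [this, sub_self]
      · have hnd : ¬ divState D (D ℓ' n).1 := by
          rw [hn]
          rintro ⟨k, k', m, m', _, h1, h2, h3⟩
          apply h3
          rw [hD, hD, h1, h2]
          exact hcom k k'
        have := hone (Or.inr hnd)
        rw [hD, hn, hcom ℓ' ℓ] at this
        rw [this, sub_self]
    · linarith [(hat_pol D ℓ).1 x (π ℓ x)]
  have hNd : ∀ x, N * nuData M Nl π x = ∑ k, (Nl k : ℝ) * stateOcc M (detPolicy (π k)) x := by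
    intro x
    unfold nuData
    rw [← hN]
    field_simp
  have hnn : ∀ x, 0 ≤ nuData M Nl π x := fun x =>
    div_nonneg (Finset.sum_nonneg fun k _ => mul_nonneg (Nat.cast_nonneg _)
      (stateOcc_nonneg M (detPolicy_isPolicy (π k)) x)) hN0.le
  have hC : ∀ x, ν x / nuData M Nl π x ≤ concentr M Nl π ℓ := fun x =>
    Finset.le_sup' (fun x => stateOcc M (detPolicy (π ℓ)) x / nuData M Nl π x) (Finset.mem_univ x)
  have hC0 : 0 ≤ concentr M Nl π ℓ :=
    (div_nonneg (hν0 (Classical.arbitrary X)) (hnn _)).trans (hC (Classical.arbitrary X))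
  have hνC : ∀ x, ν x ≤ concentr M Nl π ℓ * nuData M Nl π x := by
    intro x
    rcases (hnn x).eq_or_lt with h0 | hpos
    · have h1 : (Nl ℓ : ℝ) * ν x ≤ N * nuData M Nl π x := by
        rw [hNd]
        exact Finset.single_le_sum (f := fun k => (Nl k : ℝ) * stateOcc M (detPolicy (π k)) x)
          (fun k _ => mul_nonneg (Nat.cast_nonneg _)
            (stateOcc_nonneg M (detPolicy_isPolicy (π k)) x)) (Finset.mem_univ ℓ)
      rw [← h0, mul_zero] at h1
      rw [← h0, mul_zero]
      by_contra hneg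
      push Not at hneg
      linarith [mul_pos hNl0 hneg]
    · exact (div_le_iff₀ hpos).1 (hC x)
  have hcommon : ∀ x, (∀ k k' : Fin L, π k x = π k' x) →
      ν x * ∑ D : DataSets L Nl X A, dataProb M π D * (1 - hat D ℓ x (π ℓ x))
        ≤ concentr M Nl π ℓ / (Real.exp 1 * N) := by
    intro x hx
    have h1 := hS Finset.univ x (fun _ _ => Or.inr hx)
    rw [← hNd] at h1
    have h2 := mul_exp_neg_le N (nuData M Nl π x) hN0
    calc _ ≤ ν x * Real.exp (-(N * nuData M Nl π x)) := mul_le_mul_of_nonneg_left h1 (hν0 x)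
      _ ≤ concentr M Nl π ℓ * nuData M Nl π x * Real.exp (-(N * nuData M Nl π x)) :=
        mul_le_mul_of_nonneg_right (hνC x) (Real.exp_pos _).le
      _ = concentr M Nl π ℓ * (nuData M Nl π x * Real.exp (-(N * nuData M Nl π x))) := by ring
      _ ≤ concentr M Nl π ℓ * (1 / (Real.exp 1 * N)) := mul_le_mul_of_nonneg_left h2 hC0
      _ = _ := by ring
  have hdiff : ∀ x,
      ν x * ∑ D : DataSets L Nl X A, dataProb M π D * (1 - hat D ℓ x (π ℓ x))
        ≤ 1 / (Real.exp 1 * (Nl ℓ : ℝ)) := by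
    intro x
    have h1 := hS {ℓ} x (fun k hk => Or.inl (Finset.mem_singleton.1 hk))
    rw [Finset.sum_singleton] at h1
    exact (mul_le_mul_of_nonneg_left h1 (hν0 x)).trans (mul_exp_neg_le _ _ hNl0)
  have hsum : ∑ x, ν x * ∑ D : DataSets L Nl X A, dataProb M π D * (1 - hat D ℓ x (π ℓ x))
      ≤ (commonCard π : ℝ) * (concentr M Nl π ℓ / (Real.exp 1 * N))
        + ((Fintype.card X : ℝ) - commonCard π) * (1 / (Real.exp 1 * (Nl ℓ : ℝ))) := by
    rw [← Finset.sum_filter_add_sum_filter_not Finset.univ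
      (fun x => ∀ k k' : Fin L, π k x = π k' x)]
    have hcard : ((Finset.univ.filter fun x => ¬ ∀ k k' : Fin L, π k x = π k' x).card : ℝ)
        = (Fintype.card X : ℝ) - commonCard π := by
      have := Finset.card_filter_add_card_filter_not (s := (Finset.univ : Finset X))
        (fun x => ∀ k k' : Fin L, π k x = π k' x)
      rw [Finset.card_univ] at this
      rw [← this]
      unfold commonCard
      push_cast
      ring
    refine add_le_add ?_ ?_
    · have := Finset.sum_le_card_nsmul
        (Finset.univ.filter fun x => ∀ k k' : Fin L, π k x = π k' x) _ _ (fun x hx => hcommon x (Finset.mem_filter.1 hx).2)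
      simpa only [nsmul_eq_mul, commonCard] using this
    · rw [← hcard]
      have := Finset.sum_le_card_nsmul
        (Finset.univ.filter fun x => ¬ ∀ k k' : Fin L, π k x = π k' x) _ _ (fun x _ => hdiff x)
      simpa only [nsmul_eq_mul] using this
  refine hstep1.trans ((mul_le_mul_of_nonneg_left hsum (by positivity)).trans (le_of_eq ?_))
  unfold mabcEps
  rw [← hN]
  field_simp
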